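/- In the root system of type G₂ with highest root θ, the number of upper sets Φ of the poset of positive roots (Δ⁺, ≤) such that θ ∉ Φ² (where Φ² = {α + β : α, β ∈ Φ} ∩ Δ⁺) is 4 = 2²; equivalently, the Borel subalgebra of the simple Lie algebra of type G₂ has exactly 4 abelian ideals. -/

import Mathlib

/-- The roots of the root system of type `G₂`, realized as the integer vectors of coordinate
sum `0` in `ℤ³` of squared length `2` (`eᵢ - eⱼ`, the short roots) or `6`
(`±(2eᵢ - eⱼ - eₖ)`, the long roots). -/
def G2roots : Set (Fin 3 → ℤ) :=
  {v | ∑ i, v i = 0 ∧ (∑ i, v i ^ 2 = 2 ∨ ∑ i, v i ^ 2 = 6)}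

/-- A system of positive roots for `G₂`: the roots on which the (generic) linear functional
`v ↦ v 0 + 4 * v 2` is positive. -/
def G2pos : Set (Fin 3 → ℤ) :=
  {v | v ∈ G2roots ∧ 0 < v 0 + 4 * v 2}

/-- The partial order on positive roots: `α ≤ β` iff `β − α` is a (possibly empty) sum of
positive roots. -/
def rootLe (pos : Set (Fin 3 → ℤ)) (a b : Fin 3 → ℤ) : Prop :=
  ∃ l : Multiset (Fin 3 → ℤ), (∀ x ∈ l, x ∈ pos) ∧ b = a + l.sum

theorem mem_G2pos_iff {v : Fin 3 → ℤ} : v ∈ G2pos ↔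
    v = ![1, -1, 0] ∨ v = ![-2, 1, 1] ∨ v = ![-1, 0, 1] ∨ v = ![0, -1, 1] ∨
      v = ![1, -2, 1] ∨ v = ![-1, -1, 2] := by
  constructor
  · rintro ⟨⟨hs, hq⟩, hp⟩
    simp only [Fin.sum_univ_three] at hs hq
    obtain ⟨x, y, z, rfl⟩ : ∃ x y z, v = ![x, y, z] :=
      ⟨v 0, v 1, v 2, by ext i; fin_cases i <;> rfl⟩
    simp only [Matrix.cons_val] at hs hq hp
    have hx : -2 ≤ x ∧ x ≤ 2 := by
      constructor <;> rcases hq with h | h <;> nlinarith [sq_nonneg y, sq_nonneg z]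
    have hy : -2 ≤ y ∧ y ≤ 2 := by
      constructor <;> rcases hq with h | h <;> nlinarith [sq_nonneg x, sq_nonneg z]
    obtain ⟨hx₁, hx₂⟩ := hx
    obtain ⟨hy₁, hy₂⟩ := hy
    obtain rfl : z = -x - y := by linarith
    interval_cases x <;> interval_cases y <;> simp at hq hp ⊢
  · rintro (rfl | rfl | rfl | rfl | rfl | rfl) <;>
      simp [G2pos, G2roots, Fin.sum_univ_three]

theorem rootLe_add_of_mem {pos : Set (Fin 3 → ℤ)} {a b c : Fin 3 → ℤ} (hb : b ∈ pos)
    (h : c = a + b) : rootLe pos a c :=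
  ⟨{b}, by simpa using hb, by simpa using h⟩

theorem rootLe.functional_le {a b : Fin 3 → ℤ} (h : rootLe G2pos a b) :
    a 0 + 4 * a 2 ≤ b 0 + 4 * b 2 := by
  obtain ⟨l, hl, rfl⟩ := h
  have key : 0 ≤ l.sum 0 + 4 * l.sum 2 := by
    induction l using Multiset.induction with
    | empty => simp
    | cons x s ih =>
      have hx := (hl x (Multiset.mem_cons_self x s)).2
      have hs := ih fun y hy => hl y (Multiset.mem_cons_of_mem hy)
      simp only [Multiset.sum_cons, Pi.add_apply]
      linarith
  simp only [Pi.add_apply]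
  linarith

/-- The positive roots on which the defining functional of `G2pos` is at least `c`. -/
def G2upper (c : ℤ) : Set (Fin 3 → ℤ) :=
  {v | v ∈ G2pos ∧ c ≤ v 0 + 4 * v 2}

theorem injOn_G2upper : Set.InjOn G2upper {4, 5, 7, 8} := by
  have h (c d : ℤ) (hcd : G2upper c = G2upper d) (v) (hv : v ∈ G2pos) :
      c ≤ v 0 + 4 * v 2 ↔ d ≤ v 0 + 4 * v 2 := by
    simpa [G2upper, hv] using Set.ext_iff.1 hcd v
  intro c hc d hd hcd
  have h₄ := h c d hcd ![0, -1, 1] (mem_G2pos_iff.2 (by simp))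
  have h₅ := h c d hcd ![1, -2, 1] (mem_G2pos_iff.2 (by simp))
  have h₇ := h c d hcd ![-1, -1, 2] (mem_G2pos_iff.2 (by simp))
  simp only [Matrix.cons_val] at h₄ h₅ h₇
  simp only [Set.mem_insert_iff, Set.mem_singleton_iff] at hc hd
  omega

theorem eq_of_highest {θ : Fin 3 → ℤ} (hθ : θ ∈ G2pos ∧ ∀ α ∈ G2pos, rootLe G2pos α θ) :
    θ = ![-1, -1, 2] := by
  have h := (hθ.2 ![-1, -1, 2] (mem_G2pos_iff.2 (by simp))).functional_le
  rcases mem_G2pos_iff.1 hθ.1 with rfl | rfl | rfl | rfl | rfl | rfl <;> simp at h ⊢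

theorem exists_eq_G2upper {Φ : Set (Fin 3 → ℤ)} (hΦ : Φ ⊆ G2pos)
    (hup : ∀ α ∈ Φ, ∀ β ∈ G2pos, rootLe G2pos α β → β ∈ Φ)
    (hab : ∀ α ∈ Φ, ∀ β ∈ Φ, ![-1, -1, 2] ≠ α + β) :
    ∃ c ∈ ({4, 5, 7, 8} : Set ℤ), G2upper c = Φ := by
  have step (a b c : Fin 3 → ℤ) (hb : b ∈ G2pos) (hc : c ∈ G2pos) (h : c = a + b)
      (ha : a ∈ Φ) : c ∈ Φ := hup a ha c hc (rootLe_add_of_mem hb h)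
  have h₁₃ := step ![1, -1, 0] ![-2, 1, 1] ![-1, 0, 1] (mem_G2pos_iff.2 (by simp))
    (mem_G2pos_iff.2 (by simp)) (by simp)
  have h₂₃ := step ![-2, 1, 1] ![1, -1, 0] ![-1, 0, 1] (mem_G2pos_iff.2 (by simp))
    (mem_G2pos_iff.2 (by simp)) (by simp)
  have h₃₄ := step ![-1, 0, 1] ![1, -1, 0] ![0, -1, 1] (mem_G2pos_iff.2 (by simp))
    (mem_G2pos_iff.2 (by simp)) (by simp)
  have h₄₅ := step ![0, -1, 1] ![1, -1, 0] ![1, -2, 1] (mem_G2pos_iff.2 (by simp))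
    (mem_G2pos_iff.2 (by simp)) (by simp)
  have h₅₇ := step ![1, -2, 1] ![-2, 1, 1] ![-1, -1, 2] (mem_G2pos_iff.2 (by simp))
    (mem_G2pos_iff.2 (by simp)) (by simp)
  have h₃ : ![-1, 0, 1] ∉ Φ := fun h => hab _ h _ (h₃₄ h) (by simp)
  have h₁ : ![1, -1, 0] ∉ Φ := fun h => h₃ (h₁₃ h)
  have h₂ : ![-2, 1, 1] ∉ Φ := fun h => h₃ (h₂₃ h)
  have eq_upper (c : ℤ) (h : ∀ v ∈ G2pos, c ≤ v 0 + 4 * v 2 ↔ v ∈ Φ) : G2upper c = Φ :=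
    Set.ext fun v => ⟨fun hv => (h v hv.1).1 hv.2, fun hv => ⟨hΦ hv, (h v (hΦ hv)).2 hv⟩⟩
  by_cases h₄ : ![0, -1, 1] ∈ Φ
  · refine ⟨4, by simp, eq_upper 4 fun v hv => ?_⟩
    rcases mem_G2pos_iff.1 hv with rfl | rfl | rfl | rfl | rfl | rfl <;> simp_all
  by_cases h₅ : ![1, -2, 1] ∈ Φ
  · refine ⟨5, by simp, eq_upper 5 fun v hv => ?_⟩
    rcases mem_G2pos_iff.1 hv with rfl | rfl | rfl | rfl | rfl | rfl <;> simp_all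
  by_cases h₇ : ![-1, -1, 2] ∈ Φ
  · refine ⟨7, by simp, eq_upper 7 fun v hv => ?_⟩
    rcases mem_G2pos_iff.1 hv with rfl | rfl | rfl | rfl | rfl | rfl <;> simp_all
  · refine ⟨8, by simp, eq_upper 8 fun v hv => ?_⟩
    rcases mem_G2pos_iff.1 hv with rfl | rfl | rfl | rfl | rfl | rfl <;> simp_all

/-- In the root system of type `G₂` with highest root `θ`, the number of
upper sets `Φ` of the poset of positive roots `(Δ⁺, ≤)` such that `θ ∉ Φ²` (where
`Φ² = {α + β : α, β ∈ Φ} ∩ Δ⁺`) is `4 = 2²`; equivalently, the Borel subalgebra of the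
simple Lie algebra of type `G₂` has exactly `4` abelian ideals. -/
theorem stmt18 (θ : Fin 3 → ℤ)
    (hθ : θ ∈ G2pos ∧ ∀ α ∈ G2pos, rootLe G2pos α θ) :
    {Φ : Set (Fin 3 → ℤ) | Φ ⊆ G2pos ∧
      (∀ α ∈ Φ, ∀ β ∈ G2pos, rootLe G2pos α β → β ∈ Φ) ∧
      θ ∉ {γ | ∃ α ∈ Φ, ∃ β ∈ Φ, γ = α + β} ∩ G2pos}.ncard = 4 := by
  have hθ' := eq_of_highest hθ
  trans (G2upper '' {4, 5, 7, 8}).ncard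
  · congr 1
    ext Φ
    constructor
    · rintro ⟨hΦ, hup, hab⟩
      refine exists_eq_G2upper hΦ hup fun α hα β hβ h => hab ⟨⟨α, hα, β, hβ, ?_⟩, hθ.1⟩
      rw [hθ', h]
    · rintro ⟨c, hc, rfl⟩
      refine ⟨fun v hv => hv.1, fun α hα β hβ h => ⟨hβ, hα.2.trans h.functional_le⟩, ?_⟩
      rintro ⟨⟨α, hα, β, hβ, h⟩, -⟩
      have h₀ := congrFun (hθ'.symm.trans h) 0
      have h₂ := congrFun (hθ'.symm.trans h) 2
      simp only [Matrix.cons_val, Pi.add_apply] at h₀ h₂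
      have hα' := hα.2
      have hβ' := hβ.2
      simp only [Set.mem_insert_iff, Set.mem_singleton_iff] at hc
      omega
  · rw [injOn_G2upper.ncard_image]
    have : ({4, 5, 7, 8} : Set ℤ) = (({4, 5, 7, 8} : Finset ℤ) : Set ℤ) := by simp
    rw [this, Set.ncard_coe_finset]
    rfl
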